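/- SED(G₁, G₂) = 0 if and only if G₁ is subgraph isomorphic to G₂ (with the binary label cost). -/

import Mathlib

open scoped BigOperators

/-- A labelled undirected graph: a finite set of nodes (drawn from the universe `ℕ`),
a finite set of undirected edges on these nodes, and labels in `α` on nodes and edges.
`ε` is the special empty label, which no real node or edge carries. -/
structure LGraph (α : Type) (ε : α) where
  V : Finset ℕ
  E : Finset (Sym2 ℕ)
  edge_mem : ∀ e ∈ E, ∀ v ∈ e, v ∈ V
  Lv : ℕ → α
  Le : Sym2 ℕ → α
  Lv_ne : ∀ v ∈ V, Lv v ≠ ε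
  Le_ne : ∀ e ∈ E, Le e ≠ ε

variable {α : Type} {ε : α}

/-- A graph mapping between `G₁` and `G₂`: a bijection between the extended graphs
(obtained by adding dummy ε-labelled nodes and edges) in which no dummy is matched with a
dummy.  It is encoded by the set `dom` of nodes of `G₁` matched to real nodes of `G₂`
together with the (injective) matching function `f`; nodes of `G₁` outside `dom` are
matched with dummy nodes (deleted), nodes of `G₂` outside `f '' dom` are images of dummy
nodes (inserted).  The induced mapping of edges sends `e ∈ E₁` to `Sym2.map f e`, which is
a real edge of `G₂` precisely when both endpoints are matched and the image is in `E₂`. -/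
structure GMap (G₁ G₂ : LGraph α ε) where
  dom : Finset ℕ
  dom_sub : dom ⊆ G₁.V
  f : ℕ → ℕ
  maps_to : ∀ v ∈ dom, f v ∈ G₂.V
  injOn : ∀ v ∈ dom, ∀ w ∈ dom, f v = f w → v = w

-- The edges of `G₁` matched with real edges of `G₂` under the mapping.
open Classical in
noncomputable def GMap.matchedEdges {G₁ G₂ : LGraph α ε} (π : GMap G₁ G₂) :
    Finset (Sym2 ℕ) :=
  G₁.E.filter fun e => (∀ v ∈ e, v ∈ π.dom) ∧ e.map π.f ∈ G₂.E

-- The cost `GED_π(G₁,G₂)` of a graph mapping `π` under label cost `d`: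
-- the sum over all (extended) nodes of `d(L(v), L(π v))` plus the sum over all (extended)
-- edges of `d(L(e), L(π e))`; dummy nodes and edges carry the label `ε`.
open Classical in
noncomputable def GMap.cost (d : α → α → ℝ) {G₁ G₂ : LGraph α ε} (π : GMap G₁ G₂) : ℝ :=
  (∑ v ∈ π.dom, d (G₁.Lv v) (G₂.Lv (π.f v)))
    + (∑ v ∈ G₁.V \ π.dom, d (G₁.Lv v) ε)
    + (∑ w ∈ G₂.V \ π.dom.image π.f, d ε (G₂.Lv w))
    + (∑ e ∈ π.matchedEdges, d (G₁.Le e) (G₂.Le (e.map π.f)))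
    + (∑ e ∈ G₁.E \ π.matchedEdges, d (G₁.Le e) ε)
    + (∑ e ∈ G₂.E \ π.matchedEdges.image (Sym2.map π.f), d ε (G₂.Le e))

/-- Graph edit distance under label cost `d`: the minimum of `GED_π` over all mappings. -/
noncomputable def GED (d : α → α → ℝ) (G₁ G₂ : LGraph α ε) : ℝ :=
  sInf { c | ∃ π : GMap G₁ G₂, c = π.cost d }

/-- `S` is a subgraph of `G`. -/
def IsSubgraph (S G : LGraph α ε) : Prop :=
  S.V ⊆ G.V ∧ S.E ⊆ G.E ∧ (∀ v ∈ S.V, S.Lv v = G.Lv v) ∧ (∀ e ∈ S.E, S.Le e = G.Le e)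

/-- Subgraph edit distance: the minimum of `GED(G₁, S)` over all subgraphs `S ⊆ G₂`. -/
noncomputable def SED (d : α → α → ℝ) (G₁ G₂ : LGraph α ε) : ℝ :=
  sInf { c | ∃ S : LGraph α ε, IsSubgraph S G₂ ∧ c = GED d G₁ S }

-- The binary label cost: `1` on distinct labels, `0` on equal labels.
open Classical in
noncomputable def dBin (α : Type) : α → α → ℝ := fun a b => if a = b then 0 else 1

-- The modified label cost ignoring insertions.
open Classical in
noncomputable def dHat (ε : α) (d : α → α → ℝ) : α → α → ℝ :=
  fun a b => if a = ε then 0 else d a b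

/-- `G₁` is subgraph isomorphic to `G₂`: there is an injection from the nodes of `G₁` to
the nodes of `G₂` preserving node labels, mapping edges of `G₁` to edges of `G₂`, and
preserving edge labels. -/
def SubgraphIsomorphic {α : Type} {ε : α} (G₁ G₂ : LGraph α ε) : Prop :=
  ∃ g : ℕ → ℕ, Set.InjOn g ↑G₁.V ∧ (∀ v ∈ G₁.V, g v ∈ G₂.V) ∧
    (∀ v ∈ G₁.V, G₂.Lv (g v) = G₁.Lv v) ∧
    (∀ e ∈ G₁.E, e.map g ∈ G₂.E) ∧ (∀ e ∈ G₁.E, G₂.Le (e.map g) = G₁.Le e)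

theorem sInf_mem_of_nat (A : Set ℝ) (hne : A.Nonempty) (h : ∀ a ∈ A, ∃ n : ℕ, a = n) :
    sInf A ∈ A := by
  have hT : {n : ℕ | (n : ℝ) ∈ A}.Nonempty := by
    obtain ⟨a, ha⟩ := hne
    obtain ⟨n, rfl⟩ := h a ha
    exact ⟨n, ha⟩
  have hm := Nat.sInf_mem hT
  have hl : IsLeast A ((sInf {n : ℕ | (n : ℝ) ∈ A} : ℕ) : ℝ) := by
    refine ⟨hm, ?_⟩
    intro a ha
    obtain ⟨n, rfl⟩ := h a ha
    exact_mod_cast Nat.sInf_le ha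
  rw [hl.csInf_eq]
  exact hm

theorem dBin_sum_nat {α ι : Type} (s : Finset ι) (a b : ι → α) :
    ∃ n : ℕ, (∑ i ∈ s, dBin α (a i) (b i)) = n := by
  classical
  refine ⟨∑ i ∈ s, if a i = b i then 0 else 1, ?_⟩
  push_cast
  refine Finset.sum_congr rfl fun i _ => ?_
  unfold dBin
  split_ifs <;> rfl

theorem dBin_sum_eq_zero {α ι : Type} (s : Finset ι) (a b : ι → α) :
    (∑ i ∈ s, dBin α (a i) (b i)) = 0 ↔ ∀ i ∈ s, a i = b i := by
  classical
  rw [Finset.sum_eq_zero_iff_of_nonneg]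
  · simp [dBin]
  · intro i _
    unfold dBin
    split_ifs <;> norm_num

theorem cost_nat {α : Type} {ε : α} {G₁ G₂ : LGraph α ε} (π : GMap G₁ G₂) :
    ∃ n : ℕ, π.cost (dBin α) = n := by
  classical
  obtain ⟨n1, h1⟩ := dBin_sum_nat π.dom (fun v => G₁.Lv v) (fun v => G₂.Lv (π.f v))
  obtain ⟨n2, h2⟩ := dBin_sum_nat (G₁.V \ π.dom) (fun v => G₁.Lv v) (fun _ => ε)
  obtain ⟨n3, h3⟩ := dBin_sum_nat (G₂.V \ π.dom.image π.f) (fun _ => ε) (fun v => G₂.Lv v)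
  obtain ⟨n4, h4⟩ := dBin_sum_nat π.matchedEdges (fun e => G₁.Le e)
    (fun e => G₂.Le (e.map π.f))
  obtain ⟨n5, h5⟩ := dBin_sum_nat (G₁.E \ π.matchedEdges) (fun e => G₁.Le e) (fun _ => ε)
  obtain ⟨n6, h6⟩ := dBin_sum_nat (G₂.E \ π.matchedEdges.image (Sym2.map π.f))
    (fun _ => ε) (fun e => G₂.Le e)
  refine ⟨n1 + n2 + n3 + n4 + n5 + n6, ?_⟩
  push_cast
  rw [← h1, ← h2, ← h3, ← h4, ← h5, ← h6]
  unfold GMap.cost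
  congr!

theorem GED_mem {α : Type} {ε : α} (G₁ G₂ : LGraph α ε) :
    ∃ π : GMap G₁ G₂, GED (dBin α) G₁ G₂ = π.cost (dBin α) := by
  have := sInf_mem_of_nat { c | ∃ π : GMap G₁ G₂, c = π.cost (dBin α) }
    ⟨_, ⟨∅, by simp, id, by simp, by simp⟩, rfl⟩
    (by rintro _ ⟨π, rfl⟩; exact cost_nat π)
  exact this

theorem GED_nonneg {α : Type} {ε : α} (G₁ G₂ : LGraph α ε) : 0 ≤ GED (dBin α) G₁ G₂ := by
  obtain ⟨π, h⟩ := GED_mem G₁ G₂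
  obtain ⟨n, hn⟩ := cost_nat π
  rw [h, hn]
  positivity

theorem SED_mem {α : Type} {ε : α} (G₁ G₂ : LGraph α ε) :
    ∃ S : LGraph α ε, IsSubgraph S G₂ ∧ SED (dBin α) G₁ G₂ = GED (dBin α) G₁ S := by
  have := sInf_mem_of_nat { c | ∃ S : LGraph α ε, IsSubgraph S G₂ ∧ c = GED (dBin α) G₁ S }
    ⟨_, G₂, ⟨subset_rfl, subset_rfl, fun _ _ => rfl, fun _ _ => rfl⟩, rfl⟩
    (by
      rintro _ ⟨S, -, rfl⟩
      obtain ⟨π, h⟩ := GED_mem G₁ S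
      rw [h]
      exact cost_nat π)
  exact this

theorem cost_eq_zero {α : Type} {ε : α} {G₁ G₂ : LGraph α ε} (π : GMap G₁ G₂)
    (h : π.cost (dBin α) = 0) :
    (∀ v ∈ G₁.V, v ∈ π.dom ∧ G₁.Lv v = G₂.Lv (π.f v)) ∧
    (∀ e ∈ G₁.E, e.map π.f ∈ G₂.E ∧ G₁.Le e = G₂.Le (e.map π.f)) := by
  classical
  have nn : ∀ {ι : Type} (s : Finset ι) (a b : ι → α), 0 ≤ ∑ i ∈ s, dBin α (a i) (b i) := by
    intro ι s a b
    obtain ⟨n, hn⟩ := dBin_sum_nat s a b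
    rw [hn]
    positivity
  have h1 := nn π.dom (fun v => G₁.Lv v) (fun v => G₂.Lv (π.f v))
  have h2 := nn (G₁.V \ π.dom) (fun v => G₁.Lv v) (fun _ => ε)
  have h3 := nn (G₂.V \ π.dom.image π.f) (fun _ => ε) (fun v => G₂.Lv v)
  have h4 := nn π.matchedEdges (fun e => G₁.Le e) (fun e => G₂.Le (e.map π.f))
  have h5 := nn (G₁.E \ π.matchedEdges) (fun e => G₁.Le e) (fun _ => ε)
  have h6 := nn (G₂.E \ π.matchedEdges.image (Sym2.map π.f)) (fun _ => ε) (fun e => G₂.Le e)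
  have hs : (∑ v ∈ π.dom, dBin α (G₁.Lv v) (G₂.Lv (π.f v)))
    + (∑ v ∈ G₁.V \ π.dom, dBin α (G₁.Lv v) ε)
    + (∑ w ∈ G₂.V \ π.dom.image π.f, dBin α ε (G₂.Lv w))
    + (∑ e ∈ π.matchedEdges, dBin α (G₁.Le e) (G₂.Le (e.map π.f)))
    + (∑ e ∈ G₁.E \ π.matchedEdges, dBin α (G₁.Le e) ε)
    + (∑ e ∈ G₂.E \ π.matchedEdges.image (Sym2.map π.f), dBin α ε (G₂.Le e)) = 0 := by
    rw [← h]
    unfold GMap.cost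
    congr!
  have e1 := (dBin_sum_eq_zero π.dom (fun v => G₁.Lv v) (fun v => G₂.Lv (π.f v))).1
    (by linarith)
  have e2 := (dBin_sum_eq_zero (G₁.V \ π.dom) (fun v => G₁.Lv v) (fun _ => ε)).1 (by linarith)
  have e4 := (dBin_sum_eq_zero π.matchedEdges (fun e => G₁.Le e)
    (fun e => G₂.Le (e.map π.f))).1 (by linarith)
  have e5 := (dBin_sum_eq_zero (G₁.E \ π.matchedEdges) (fun e => G₁.Le e) (fun _ => ε)).1
    (by linarith)
  constructor
  · intro v hv
    have hd : v ∈ π.dom := by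
      by_contra hd
      exact G₁.Lv_ne v hv (e2 v (Finset.mem_sdiff.2 ⟨hv, hd⟩))
    exact ⟨hd, e1 v hd⟩
  · intro e he
    have hd : e ∈ π.matchedEdges := by
      by_contra hd
      exact G₁.Le_ne e he (e5 e (Finset.mem_sdiff.2 ⟨he, hd⟩))
    refine ⟨?_, e4 e hd⟩
    unfold GMap.matchedEdges at hd
    exact (Finset.mem_filter.1 hd).2.2

/-- `SED(G₁, G₂) = 0` iff `G₁` is subgraph isomorphic to `G₂`
(binary label cost). -/
theorem sed_eq_zero_iff_subgraph_isomorphic {α : Type} {ε : α} (G₁ G₂ : LGraph α ε) :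
    SED (dBin α) G₁ G₂ = 0 ↔ SubgraphIsomorphic G₁ G₂ := by
  classical
  constructor
  · intro h
    obtain ⟨S, ⟨hV, hE, hLv, hLe⟩, hS⟩ := SED_mem G₁ G₂
    obtain ⟨π, hπ⟩ := GED_mem G₁ S
    obtain ⟨hv, he⟩ := cost_eq_zero π (by rw [← hπ, ← hS, h])
    refine ⟨π.f, ?_, ?_, ?_, ?_, ?_⟩
    · intro v hv1 w hw1 hvw
      exact π.injOn v (hv v hv1).1 w (hv w hw1).1 hvw
    · intro v hv1
      exact hV (π.maps_to v (hv v hv1).1)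
    · intro v hv1
      rw [← hLv _ (π.maps_to v (hv v hv1).1), (hv v hv1).2]
    · intro e he1
      exact hE (he e he1).1
    · intro e he1
      rw [← hLe _ (he e he1).1, (he e he1).2]
  · rintro ⟨g, hinj, hV, hLv, hE, hLe⟩
    have hVs : G₁.V.image g ⊆ G₂.V := by
      intro w hw
      obtain ⟨v, hv, rfl⟩ := Finset.mem_image.1 hw
      exact hV v hv
    have hEs : G₁.E.image (Sym2.map g) ⊆ G₂.E := by
      intro w hw
      obtain ⟨v, hv, rfl⟩ := Finset.mem_image.1 hw
      exact hE v hv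
    let S : LGraph α ε :=
      { V := G₁.V.image g
        E := G₁.E.image (Sym2.map g)
        edge_mem := by
          intro e he w hw
          obtain ⟨e', he', rfl⟩ := Finset.mem_image.1 he
          obtain ⟨v, hv, rfl⟩ := Sym2.mem_map.1 hw
          exact Finset.mem_image_of_mem g (G₁.edge_mem e' he' v hv)
        Lv := G₂.Lv
        Le := G₂.Le
        Lv_ne := fun v hv => G₂.Lv_ne v (hVs hv)
        Le_ne := fun e he => G₂.Le_ne e (hEs he) }
    let π : GMap G₁ S :=
      { dom := G₁.V
        dom_sub := subset_rfl
        f := g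
        maps_to := fun v hv => Finset.mem_image_of_mem g hv
        injOn := fun v hv w hw h => hinj hv hw h }
    have hm : π.matchedEdges = G₁.E := by
      unfold GMap.matchedEdges
      refine Finset.filter_true_of_mem ?_
      intro e he
      exact ⟨G₁.edge_mem e he, Finset.mem_image_of_mem _ he⟩
    have hc : π.cost (dBin α) = 0 := by
      have z1 := (dBin_sum_eq_zero G₁.V (fun v => G₁.Lv v) (fun v => G₂.Lv (g v))).2
        (fun v hv => (hLv v hv).symm)
      have z2 := (dBin_sum_eq_zero G₁.E (fun e => G₁.Le e) (fun e => G₂.Le (e.map g))).2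
        (fun e he => (hLe e he).symm)
      have k1 : ∀ w, w ∉ S.V \ π.dom.image π.f := by
        intro w hw
        exact (Finset.mem_sdiff.1 hw).2 (Finset.mem_sdiff.1 hw).1
      have k2 : ∀ w, w ∉ S.E \ G₁.E.image (Sym2.map π.f) := by
        intro w hw
        exact (Finset.mem_sdiff.1 hw).2 (Finset.mem_sdiff.1 hw).1
      unfold GMap.cost
      rw [hm]
      have y1 : ∑ v ∈ π.dom, dBin α (G₁.Lv v) (S.Lv (π.f v)) = 0 := z1
      have y2 : ∑ e ∈ G₁.E, dBin α (G₁.Le e) (S.Le (e.map π.f)) = 0 := z2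
      have y3 : G₁.V \ π.dom = ∅ := Finset.sdiff_self _
      rw [y1, y2]
      have q1 := Finset.eq_empty_of_forall_notMem k1
      have q2 := Finset.eq_empty_of_forall_notMem k2
      have q3 : G₁.E \ G₁.E = ∅ := Finset.sdiff_self _
      convert (add_zero (0 : ℝ)) using 2
      · convert (add_zero (0 : ℝ)) using 2
        · simp only [zero_add, add_zero]
          convert (add_zero (0 : ℝ)) using 2
          · refine Finset.sum_eq_zero fun v hv => ?_
            exact absurd (Finset.mem_sdiff.1 hv).1 (Finset.mem_sdiff.1 hv).2
          · refine Finset.sum_eq_zero fun v hv => ?_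
            exact absurd (by convert hv) (k1 v)
        · refine Finset.sum_eq_zero fun v hv => ?_
          exact absurd (Finset.mem_sdiff.1 hv).1 (Finset.mem_sdiff.1 hv).2
      · refine Finset.sum_eq_zero fun v hv => ?_
        exact absurd (by convert hv) (k2 v)
    have hged : GED (dBin α) G₁ S = 0 := by
      refine le_antisymm ?_ (GED_nonneg _ _)
      rw [← hc]
      refine csInf_le ⟨0, ?_⟩ ⟨π, rfl⟩
      rintro _ ⟨p, rfl⟩
      obtain ⟨n, hn⟩ := cost_nat p
      rw [hn]
      positivity
    obtain ⟨T, -, hT⟩ := SED_mem G₁ G₂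
    refine le_antisymm ?_ (hT ▸ GED_nonneg _ _)
    rw [← hged]
    refine csInf_le ⟨0, ?_⟩ ⟨S, ⟨hVs, hEs, fun _ _ => rfl, fun _ _ => rfl⟩, rfl⟩
    rintro _ ⟨T, -, rfl⟩
    exact GED_nonneg _ _
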